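/- arXiv:0909.1596 — 3 statements merged into one kernel-verified Lean document; each statement's English description precedes it below -/
import Mathlib

section
/- For every Hermitian matrix H in M_N(ℂ) and every finite family of matrices (V_d) in M_N(ℂ), the Lindblad generator 𝓛 has at least one steady state; that is, there exists a positive semidefinite matrix ρ with trace 1 such that 𝓛(ρ) = 0. -/
open Matrix
open scoped ComplexOrder

/-- The Lindblad generator `𝓛(ρ) = -i[H,ρ] + Σ_d (V_d ρ V_d† - ½(V_d† V_d ρ + ρ V_d† V_d))`. -/
noncomputable def lindblad {n : Type*} [Fintype n] [DecidableEq n] {ι : Type*} [Fintype ι]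
    (H : Matrix n n ℂ) (V : ι → Matrix n n ℂ) (ρ : Matrix n n ℂ) : Matrix n n ℂ :=
  -Complex.I • (H * ρ - ρ * H) +
    ∑ d, (V d * ρ * (V d)ᴴ - (1 / 2 : ℂ) • ((V d)ᴴ * V d * ρ + ρ * ((V d)ᴴ * V d)))

/-- A density matrix: positive semidefinite with trace one. -/
def IsDensityMatrix {n : Type*} [Fintype n] (ρ : Matrix n n ℂ) : Prop :=
  ρ.PosSemidef ∧ ρ.trace = 1

/-- A steady state of the Lindblad dynamics. -/
noncomputable def IsSteadyState {n : Type*} [Fintype n] [DecidableEq n] {ι : Type*} [Fintype ι]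
    (H : Matrix n n ℂ) (V : ι → Matrix n n ℂ) (ρ : Matrix n n ℂ) : Prop :=
  IsDensityMatrix ρ ∧ lindblad H V ρ = 0

/-- The support of a matrix: its range as a linear map `ℂ^N → ℂ^N`. -/
noncomputable def matSupport {n : Type*} [Fintype n] (ρ : Matrix n n ℂ) :
    Submodule ℂ (n → ℂ) :=
  LinearMap.range ρ.mulVecLin

/-- An extremal steady state: it cannot be written as a nontrivial convex combination
of two steady states other than itself. -/
noncomputable def IsExtremalSteadyState {n : Type*} [Fintype n] [DecidableEq n]
    {ι : Type*} [Fintype ι]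
    (H : Matrix n n ℂ) (V : ι → Matrix n n ℂ) (ρ : Matrix n n ℂ) : Prop :=
  IsSteadyState H V ρ ∧
    ∀ (a : ℝ) (ρ₁ ρ₂ : Matrix n n ℂ), 0 < a → a < 1 →
      IsSteadyState H V ρ₁ → IsSteadyState H V ρ₂ →
      ρ = a • ρ₁ + (1 - a) • ρ₂ → ρ₁ = ρ ∧ ρ₂ = ρ

open scoped Matrix.Norms.Elementwise MatrixOrder in
theorem isCompact_setOf_isDensityMatrix {n : Type*} [Fintype n] [DecidableEq n] :
    IsCompact {ρ : Matrix n n ℂ | IsDensityMatrix ρ} := by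
  have himage : {ρ : Matrix n n ℂ | IsDensityMatrix ρ} =
      (fun B : Matrix n n ℂ ↦ Bᴴ * B) '' {B | (Bᴴ * B).trace = 1} := by
    ext ρ
    constructor
    · rintro ⟨hρ, htr⟩
      obtain ⟨B, rfl⟩ := CStarAlgebra.nonneg_iff_eq_star_mul_self.mp hρ.nonneg
      exact ⟨B, htr, rfl⟩
    · rintro ⟨B, hB, rfl⟩
      exact ⟨Matrix.posSemidef_conjTranspose_mul_self B, hB⟩
  rw [himage]
  refine IsCompact.image ?_ (by fun_prop)
  refine Metric.isCompact_of_isClosed_isBounded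
    (isClosed_eq (by fun_prop) continuous_const) ?_
  refine (Metric.isBounded_closedBall (x := (0 : Matrix n n ℂ)) (r := 1)).subset fun B hB ↦ ?_
  have hsum : ∑ j, ∑ i, ‖B i j‖ ^ 2 = (1 : ℝ) := by
    have h : (Bᴴ * B).trace = 1 := hB
    simp only [Matrix.trace, Matrix.diag_apply, Matrix.mul_apply, Matrix.conjTranspose_apply,
      RCLike.star_def, Complex.conj_mul'] at h
    exact_mod_cast h
  rw [mem_closedBall_zero_iff, Matrix.norm_le_iff zero_le_one]
  intro i j
  have h₁ : ‖B i j‖ ^ 2 ≤ ∑ i, ‖B i j‖ ^ 2 :=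
    Finset.single_le_sum (f := fun i ↦ ‖B i j‖ ^ 2) (fun _ _ ↦ by positivity) (Finset.mem_univ i)
  have h₂ : ∑ i, ‖B i j‖ ^ 2 ≤ ∑ j, ∑ i, ‖B i j‖ ^ 2 :=
    Finset.single_le_sum (f := fun j ↦ ∑ i, ‖B i j‖ ^ 2) (fun _ _ ↦ by positivity)
      (Finset.mem_univ j)
  exact (sq_le_one_iff₀ (norm_nonneg _)).mp (by linarith)

theorem convex_setOf_isDensityMatrix {n : Type*} [Fintype n] :
    Convex ℝ {ρ : Matrix n n ℂ | IsDensityMatrix ρ} := by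
  rintro ρ ⟨hρ, hρt⟩ σ ⟨hσ, hσt⟩ a b ha hb hab
  refine ⟨(hρ.smul ha).add (hσ.smul hb), ?_⟩
  rw [Matrix.trace_add, Matrix.trace_smul, Matrix.trace_smul, hρt, hσt, ← add_smul, hab, one_smul]

section Lindblad

variable {n : Type*} [Fintype n] [DecidableEq n] {ι : Type*} [Fintype ι]
  (H : Matrix n n ℂ) (V : ι → Matrix n n ℂ)

theorem trace_lindblad (ρ : Matrix n n ℂ) : (lindblad H V ρ).trace = 0 := by
  have h (d : ι) : (V d * ρ * (V d)ᴴ - (1 / 2 : ℂ) •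
      ((V d)ᴴ * V d * ρ + ρ * ((V d)ᴴ * V d))).trace = 0 := by
    rw [Matrix.trace_sub, Matrix.trace_smul, Matrix.trace_add,
      Matrix.trace_mul_comm ρ ((V d)ᴴ * V d), Matrix.trace_mul_comm (V d * ρ) (V d)ᴴ,
      ← Matrix.mul_assoc, smul_eq_mul]
    ring
  rw [lindblad, Matrix.trace_add, Matrix.trace_sum, Finset.sum_eq_zero fun d _ ↦ h d,
    Matrix.trace_smul, Matrix.trace_sub, Matrix.trace_mul_comm H ρ]
  simp

theorem isLinearMap_lindblad : IsLinearMap ℝ (lindblad H V) where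
  map_add ρ σ := by
    simp only [lindblad, Matrix.mul_add, Matrix.add_mul, smul_add, smul_sub,
      Finset.sum_sub_distrib, Finset.sum_add_distrib]
    abel
  map_smul c ρ := by
    simp only [lindblad, Matrix.mul_smul, Matrix.smul_mul, smul_add, smul_sub, Finset.smul_sum,
      smul_comm c]

/-- The effective non-Hermitian Hamiltonian, times `-i`. -/
noncomputable def lindbladDrift : Matrix n n ℂ :=
  -Complex.I • H - (1 / 2 : ℂ) • ∑ d, (V d)ᴴ * V d

variable {H}

theorem lindblad_eq_drift (hH : H.IsHermitian) (ρ : Matrix n n ℂ) :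
    lindblad H V ρ = lindbladDrift H V * ρ + ρ * (lindbladDrift H V)ᴴ +
      ∑ d, V d * ρ * (V d)ᴴ := by
  have hadj : (lindbladDrift H V)ᴴ = Complex.I • H - (1 / 2 : ℂ) • ∑ d, (V d)ᴴ * V d := by
    simp [lindbladDrift, Matrix.conjTranspose_sum, hH.eq]
  rw [hadj, lindblad, lindbladDrift]
  simp only [Matrix.sub_mul, Matrix.mul_sub, Matrix.smul_mul, Matrix.mul_smul, Matrix.sum_mul,
    Matrix.mul_sum, Finset.sum_sub_distrib, Finset.sum_add_distrib, ← Finset.smul_sum, smul_add,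
    smul_sub, neg_smul, Matrix.neg_mul]
  abel

theorem posSemidef_add_smul_lindblad (hH : H.IsHermitian) {ρ : Matrix n n ℂ}
    (hρ : ρ.PosSemidef) {ε : ℝ} (hε : 0 ≤ ε) :
    (ρ + ε • lindblad H V ρ +
      ε ^ 2 • (lindbladDrift H V * ρ * (lindbladDrift H V)ᴴ)).PosSemidef := by
  have hsum : (∑ d, V d * ρ * (V d)ᴴ).PosSemidef :=
    Matrix.posSemidef_sum _ fun d _ ↦ hρ.mul_mul_conjTranspose_same (V d)
  convert (hρ.mul_mul_conjTranspose_same (1 + ε • lindbladDrift H V)).add (hsum.smul hε) using 1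
  rw [lindblad_eq_drift V hH]
  simp only [Matrix.conjTranspose_add, Matrix.conjTranspose_one, Matrix.conjTranspose_smul,
    star_trivial, Matrix.add_mul, Matrix.mul_add, Matrix.one_mul, Matrix.mul_one, Matrix.smul_mul,
    Matrix.mul_smul, smul_add, smul_smul, pow_two]
  abel

/-- The value of a functional cannot increase along the flow at a point maximizing it over the
density matrices. -/
theorem apply_lindblad_nonpos_of_isMaxOn (hH : H.IsHermitian) (f : Matrix n n ℂ →ₗ[ℝ] ℝ)
    {ρ : Matrix n n ℂ} (hρ : IsDensityMatrix ρ)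
    (hmax : IsMaxOn f {σ | IsDensityMatrix σ} ρ) : f (lindblad H V ρ) ≤ 0 := by
  set K := lindbladDrift H V * ρ * (lindbladDrift H V)ᴴ
  obtain ⟨t, ht, hKt⟩ : ∃ t : ℝ, 0 ≤ t ∧ K.trace = t := by
    have h := (hρ.1.mul_mul_conjTranspose_same (lindbladDrift H V)).trace_nonneg
    exact ⟨K.trace.re, (Complex.nonneg_iff.mp h).1, Complex.ext rfl (Complex.nonneg_iff.mp h).2.symm⟩
  have hle (ε : ℝ) (hε : 0 < ε) : f (lindblad H V ρ) ≤ ε * (t * f ρ - f K) := by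
    have hr : 0 < 1 + ε ^ 2 * t := by positivity
    have hpos := posSemidef_add_smul_lindblad V hH hρ.1 hε.le
    have h := hmax (a := (1 + ε ^ 2 * t)⁻¹ • (ρ + ε • lindblad H V ρ + ε ^ 2 • K))
      ⟨hpos.smul (inv_nonneg.mpr hr.le), by
        rw [Matrix.trace_smul, Matrix.trace_add, Matrix.trace_add, Matrix.trace_smul,
          Matrix.trace_smul, trace_lindblad, hKt, hρ.2, smul_zero, add_zero, Complex.real_smul,
          Complex.real_smul]
        have hr' : ((1 + ε ^ 2 * t : ℝ) : ℂ) ≠ 0 := by exact_mod_cast hr.ne'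
        rw [Complex.ofReal_inv]
        convert inv_mul_cancel₀ hr' using 2
        push_cast
        ring⟩
    simp only [Set.mem_ofPred_eq, map_smul, map_add, smul_eq_mul] at h
    rw [inv_mul_le_iff₀ hr] at h
    refine le_of_mul_le_mul_left ?_ hε
    linarith
  by_contra! hpos
  set c := t * f ρ - f K
  set a := f (lindblad H V ρ)
  have hc : 0 < |c| + 1 := by positivity
  have h := hle (a / (|c| + 1) / 2) (by positivity)
  have hb : a / (|c| + 1) * c ≤ a := by
    rw [div_mul_eq_mul_div, div_le_iff₀ hc]
    exact mul_le_mul_of_nonneg_left (by linarith [le_abs_self c]) hpos.le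
  linarith

theorem exists_isDensityMatrix_lindblad_eq_zero [Nonempty n] (hH : H.IsHermitian) :
    ∃ ρ : Matrix n n ℂ, IsDensityMatrix ρ ∧ lindblad H V ρ = 0 := by
  have : LocallyConvexSpace ℝ (Matrix n n ℂ) :=
    inferInstanceAs (LocallyConvexSpace ℝ (n → n → ℂ))
  let L := (isLinearMap_lindblad H V).mk'
  set D := {ρ : Matrix n n ℂ | IsDensityMatrix ρ}
  have hD : IsCompact D := isCompact_setOf_isDensityMatrix
  have hne : D.Nonempty := by
    have hn : (Fintype.card n : ℂ) ≠ 0 := by exact_mod_cast Fintype.card_ne_zero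
    refine ⟨(Fintype.card n : ℝ)⁻¹ • 1, Matrix.PosSemidef.one.smul (by positivity), ?_⟩
    simp [Matrix.trace_smul, hn]
  by_contra hno
  have h0 : (0 : Matrix n n ℂ) ∉ L '' D := by
    rintro ⟨ρ, hρ, h⟩
    exact hno ⟨ρ, hρ, h⟩
  obtain ⟨f, u, hu, hf⟩ := geometric_hahn_banach_point_closed
    (convex_setOf_isDensityMatrix.linear_image L)
    (hD.image L.continuous_of_finiteDimensional).isClosed h0
  obtain ⟨ρ, hρ, hmax⟩ := hD.exists_isMaxOn hne f.continuous.continuousOn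
  have hle := apply_lindblad_nonpos_of_isMaxOn V hH f.toLinearMap hρ hmax
  have hlt : u < f (lindblad H V ρ) := hf _ ⟨ρ, hρ, rfl⟩
  rw [map_zero] at hu
  exact (hu.trans hlt).not_ge hle

end Lindblad

/-- The Lindblad master equation always has a steady state. -/
theorem lindblad_exists_steady_state (N : ℕ) (hN : 1 ≤ N)
    (H : Matrix (Fin N) (Fin N) ℂ) (hH : H.IsHermitian)
    {ι : Type*} [Fintype ι] (V : ι → Matrix (Fin N) (Fin N) ℂ) :
    ∃ ρ : Matrix (Fin N) (Fin N) ℂ, IsDensityMatrix ρ ∧ lindblad H V ρ = 0 := by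
  have : Nonempty (Fin N) := ⟨⟨0, hN⟩⟩
  exact exists_isDensityMatrix_lindblad_eq_zero V hH
end

section
/- Let D be a nonempty compact convex subset of a finite-dimensional real normed vector space, and let φ : [0,∞) × D → D be a continuous semiflow, i.e., φ is jointly continuous, φ(0, x) = x for all x ∈ D, and φ(s + t, x) = φ(s, φ(t, x)) for all s, t ≥ 0 and x ∈ D. Then φ has a common fixed point: there exists x₀ ∈ D such that φ(t, x₀) = x₀ for all t ≥ 0. -/
open Polynomial in
theorem Matrix.exists_polynomial_eval_eq_det_one_add_smul {n : Type*} [Fintype n] [DecidableEq n]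
    (M : Matrix n n ℝ) :
    ∃ p : ℝ[X], p.natDegree ≤ Fintype.card n ∧ ∀ t : ℝ, (1 + t • M).det = p.eval t := by
  refine ⟨((X : ℝ[X]) • M.map C + (1 : Matrix n n ℝ).map C).det,
    Polynomial.natDegree_det_X_add_C_le M 1, fun t => ?_⟩
  rw [← coe_evalRingHom, RingHom.map_det]
  congr 1
  ext i j
  by_cases h : i = j <;> simp [h, mul_comm t, add_comm]

open Polynomial in
theorem ContinuousLinearMap.exists_polynomial_eval_eq_det_one_add_smul
    {E : Type*} [NormedAddCommGroup E] [NormedSpace ℝ E] [FiniteDimensional ℝ E] (A : E →L[ℝ] E) :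
    ∃ p : ℝ[X], p.natDegree ≤ Module.finrank ℝ E ∧
      ∀ t : ℝ, (1 + t • A).det = p.eval t := by
  obtain ⟨p, hp, hpt⟩ := Matrix.exists_polynomial_eval_eq_det_one_add_smul
    (LinearMap.toMatrix (Module.finBasis ℝ E) (Module.finBasis ℝ E) (A : E →ₗ[ℝ] E))
  refine ⟨p, by simpa using hp, fun t => ?_⟩
  rw [← hpt, ← LinearMap.toMatrix_id (Module.finBasis ℝ E), ← map_smul, ← map_add,
    LinearMap.det_toMatrix]
  rfl

theorem ContinuousLinearMap.det_one_add_pos_of_norm_lt_one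
    {E : Type*} [NormedAddCommGroup E] [NormedSpace ℝ E] [FiniteDimensional ℝ E]
    {B : E →L[ℝ] E} (hB : ‖B‖ < 1) : 0 < (1 + B).det := by
  have hne : ∀ s ∈ Set.Icc (0 : ℝ) 1, (1 + s • B).det ≠ 0 := by
    intro s hs h0
    have hnorm : ‖s • B‖ < 1 := by
      rw [norm_smul, Real.norm_of_nonneg hs.1]
      nlinarith [hs.2, norm_nonneg B]
    obtain ⟨v, hv, hv0⟩ := (Submodule.ne_bot_iff _).1 (LinearMap.bot_lt_ker_of_det_eq_zero
      (f := ((1 + s • B : E →L[ℝ] E) : E →ₗ[ℝ] E)) h0).ne'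
    have hv' : v = -((s • B) v) := eq_neg_of_add_eq_zero_left (by simpa using hv)
    have h1 : ‖v‖ ≤ ‖s • B‖ * ‖v‖ := by
      conv_lhs => rw [hv', norm_neg]
      exact (s • B).le_opNorm v
    nlinarith [norm_pos_iff.2 hv0]
  have hcont : ContinuousOn (fun s : ℝ => (1 + s • B).det) (Set.Icc 0 1) :=
    (ContinuousLinearMap.continuous_det.comp (by fun_prop)).continuousOn
  by_contra hneg
  obtain ⟨s, hs, h0⟩ := intermediate_value_Icc' zero_le_one hcont
    (show (0 : ℝ) ∈ _ from ⟨by simpa using hneg, by simp [ContinuousLinearMap.det]⟩)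
  exact hne s hs h0

open Polynomial in
theorem Polynomial.eval_eq_sum_lagrange_basis {p : ℝ[X]} {s : Finset ℝ} (hp : p.natDegree < s.card)
    (x : ℝ) : p.eval x = ∑ t ∈ s, p.eval t * (Lagrange.basis s id t).eval x := by
  have h := Lagrange.eq_interpolate (s := s) (v := id) (f := p) Function.injective_id.injOn
    (lt_of_le_of_lt Polynomial.degree_le_natDegree (by exact_mod_cast hp))
  conv_lhs => rw [h]
  simp [Lagrange.interpolate_apply, Polynomial.eval_finsetSum]

open MeasureTheory Metric Set in
theorem image_ball_add_smul_sub_eq_ball {E : Type*} [NormedAddCommGroup E] [NormedSpace ℝ E]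
    [FiniteDimensional ℝ E] {r : E → E} {R t : ℝ} (hR : 0 < R) (hr : ContDiff ℝ 1 r)
    (hnorm : ∀ x, ‖r x‖ = R) (hfix : ∀ x, ‖x‖ = R → r x = x) (ht0 : 0 ≤ t) (ht1 : t < 1)
    (hder : ∀ x ∈ ball (0 : E) R, ‖t • fderiv ℝ (fun x => r x - x) x‖ < 1) :
    (fun x => x + t • (r x - x)) '' ball (0 : E) R = ball 0 R := by
  have : CompleteSpace E := FiniteDimensional.complete ℝ E
  have hg : ContDiff ℝ 1 (fun x => x + t • (r x - x)) := by fun_prop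
  have hmaps : (fun x => x + t • (r x - x)) '' ball (0 : E) R ⊆ ball 0 R := by
    rintro _ ⟨x, hx, rfl⟩
    rw [mem_ball_zero_iff] at hx ⊢
    have h : x + t • (r x - x) = (1 - t) • x + t • r x := by module
    calc ‖x + t • (r x - x)‖ ≤ ‖(1 - t) • x‖ + ‖t • r x‖ := h ▸ norm_add_le _ _
      _ = (1 - t) * ‖x‖ + t * R := by
        rw [norm_smul, norm_smul, hnorm, Real.norm_of_nonneg ht0,
          Real.norm_of_nonneg (sub_nonneg.2 ht1.le)]
      _ < R := by nlinarith
  refine hmaps.antisymm ?_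
  have hopen : IsOpen ((fun x => x + t • (r x - x)) '' ball (0 : E) R) := by
    rw [isOpen_iff_mem_nhds]
    rintro _ ⟨x, hx, rfl⟩
    have hd : HasStrictFDerivAt (fun x => x + t • (r x - x))
        (1 + t • fderiv ℝ (fun x => r x - x) x) x :=
      (hasStrictFDerivAt_id x).add
        (((hr.sub contDiff_id).contDiffAt.hasStrictFDerivAt one_ne_zero).const_smul t)
    rw [← hd.map_nhds_eq_of_surj]
    · exact Filter.image_mem_map (isOpen_ball.mem_nhds hx)
    · have hdet := (ContinuousLinearMap.det_one_add_pos_of_norm_lt_one (hder x hx)).ne'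
      exact (LinearMap.equivOfDetNeZero _ hdet).range
  refine (convex_ball 0 R).isPreconnected.subset_left_of_subset_union hopen
    (((isCompact_closedBall 0 R).image hg.continuous).isClosed.isOpen_compl) ?_ ?_ ?_
  · exact disjoint_compl_right.mono_left (image_mono ball_subset_closedBall)
  · intro y hy
    rw [mem_union, or_iff_not_imp_right, notMem_compl_iff]
    rintro ⟨x, hx, rfl⟩
    refine ⟨x, ?_, rfl⟩
    rw [mem_closedBall_zero_iff] at hx
    rw [mem_ball_zero_iff] at hy ⊢
    refine lt_of_le_of_ne hx fun h => ?_
    simp [hfix x h, h] at hy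
  · have h0 := mem_image_of_mem (fun x => x + t • (r x - x)) (mem_ball_self hR (x := (0 : E)))
    exact ⟨_, hmaps h0, h0⟩

open MeasureTheory Metric Set in
/-- **No-retraction theorem**, smooth version. -/
theorem not_exists_contDiff_retraction_sphere {E : Type*} [NormedAddCommGroup E]
    [InnerProductSpace ℝ E] [FiniteDimensional ℝ E] {r : E → E} {R : ℝ} (hR : 0 < R)
    (hr : ContDiff ℝ 1 r) (hnorm : ∀ x, ‖r x‖ = R) (hfix : ∀ x, ‖x‖ = R → r x = x) : False := by
  borelize E
  let μ : Measure E := Measure.addHaar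
  set h' : E → E →L[ℝ] E := fderiv ℝ (fun x => r x - x)
  have hh : ContDiff ℝ 1 (fun x => r x - x) := hr.sub contDiff_id
  have hcont : Continuous h' := hh.continuous_fderiv one_ne_zero
  have hdiff : ∀ x, HasFDerivAt (fun x => r x - x) (h' x) x := fun x =>
    (hh.differentiable one_ne_zero x).hasFDerivAt
  obtain ⟨K, hK⟩ := (isCompact_closedBall (0 : E) R).exists_bound_of_continuousOn hcont.continuousOn
  have hK0 : 0 ≤ K := (norm_nonneg _).trans (hK 0 (mem_closedBall_self hR.le))
  have hKball : ∀ x ∈ ball (0 : E) R, ‖h' x‖ ≤ K := fun x hx => hK x (ball_subset_closedBall hx)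
  have hvol : ∀ t ∈ Ioo (0 : ℝ) (1 / (K + 1)),
      ∫ x in ball (0 : E) R, (1 + t • h' x).det ∂μ = μ.real (ball 0 R) := by
    rintro t ⟨ht0, ht⟩
    have htK : t * (K + 1) < 1 := (lt_div_iff₀ (by positivity)).1 ht
    have ht1 : t < 1 := by nlinarith
    have hsmall : ∀ x ∈ ball (0 : E) R, ‖t • h' x‖ < 1 := fun x hx => by
      rw [norm_smul, Real.norm_of_nonneg ht0.le]
      nlinarith [hKball x hx]
    have hinj : InjOn (fun x => x + t • (r x - x)) (ball (0 : E) R) := by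
      intro x hx y hy hxy
      have hlip := (convex_ball (0 : E) R).norm_image_sub_le_of_norm_hasFDerivWithin_le
        (fun z _ => (hdiff z).hasFDerivWithinAt) hKball hy hx
      have heq : x - y = -(t • ((r x - x) - (r y - y))) := by
        rw [smul_sub, neg_sub, sub_eq_sub_iff_add_eq_add]
        exact hxy.trans (add_comm _ _)
      have hle : ‖x - y‖ ≤ t * (K * ‖x - y‖) := by
        conv_lhs => rw [heq, norm_neg, norm_smul, Real.norm_of_nonneg ht0.le]
        gcongr
      have : ‖x - y‖ = 0 := by
        nlinarith [norm_nonneg (x - y)]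
      exact sub_eq_zero.1 (norm_eq_zero.1 this)
    have hcv := integral_image_eq_integral_abs_det_fderiv_smul μ measurableSet_ball
      (fun x _ => ((hasFDerivAt_id x).add ((hdiff x).const_smul t)).hasFDerivWithinAt)
      hinj (fun _ => (1 : ℝ))
    change ∫ x in (fun x => x + t • (r x - x)) '' ball (0 : E) R, (1 : ℝ) ∂μ =
      ∫ x in ball (0 : E) R, |(1 + t • h' x).det| • (1 : ℝ) ∂μ at hcv
    rw [image_ball_add_smul_sub_eq_ball hR hr hnorm hfix ht0.le ht1 hsmall] at hcv
    rw [show μ.real (ball (0 : E) R) = ∫ x in ball (0 : E) R, (1 : ℝ) ∂μ by simp, hcv]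
    refine setIntegral_congr_fun measurableSet_ball fun x hx => ?_
    simp [abs_of_pos (ContinuousLinearMap.det_one_add_pos_of_norm_lt_one (hsmall x hx))]
  have hdet : ∀ x, (1 + (1 : ℝ) • h' x).det = 0 := by
    intro x
    have hr' : HasFDerivAt r (1 + (1 : ℝ) • h' x) x := by
      have := (hasFDerivAt_id x).add (hdiff x)
      simpa [one_smul, ContinuousLinearMap.one_def, Function.comp_def, Pi.add_def] using this
    have hconst := hr'.norm_sq
    have hzero : HasFDerivAt (fun y => ‖r y‖ ^ 2) (0 : E →L[ℝ] ℝ) x := by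
      simp only [hnorm]
      exact hasFDerivAt_const _ _
    have horth := hconst.unique hzero
    by_contra hne
    obtain ⟨v, hv⟩ := (LinearMap.equivOfDetNeZero _ hne).surjective (r x)
    have hv' : (1 + (1 : ℝ) • h' x) v = r x := hv
    have := DFunLike.congr_fun horth v
    simp only [_root_.smul_apply, ContinuousLinearMap.comp_apply, hv'] at this
    simp [hnorm, hR.ne'] at this
  obtain ⟨s, hs, hcard⟩ := (Ioo_infinite (show (0 : ℝ) < 1 / (K + 1) by positivity))
    |>.exists_subset_card_eq (Module.finrank ℝ E + 1)
  have hlag : ∀ x, ∑ t ∈ s, (1 + t • h' x).det * (Lagrange.basis s id t).eval 1 = 0 := by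
    intro x
    obtain ⟨p, hp, hpt⟩ := (h' x).exists_polynomial_eval_eq_det_one_add_smul
    simp only [← hdet x, hpt]
    exact (Polynomial.eval_eq_sum_lagrange_basis (by omega) 1).symm
  have hsum : ∑ t ∈ s, (Lagrange.basis s id t).eval (1 : ℝ) = 1 := by
    have := Polynomial.eval_eq_sum_lagrange_basis (p := 1) (s := s) (by simp [hcard]) 1
    simpa using this.symm
  have hint : ∀ t ∈ s, Integrable
      (fun x => (1 + t • h' x).det * (Lagrange.basis s id t).eval 1) (μ.restrict (ball 0 R)) := by
    intro t _
    refine Integrable.mul_const ?_ _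
    have hc : Continuous (fun x => (1 + t • h' x).det) :=
      ContinuousLinearMap.continuous_det.comp (by fun_prop)
    exact (hc.continuousOn.integrableOn_compact (isCompact_closedBall 0 R)).mono_set
      ball_subset_closedBall
  have hfinal : ∫ x in ball (0 : E) R,
      ∑ t ∈ s, (1 + t • h' x).det * (Lagrange.basis s id t).eval 1 ∂μ = μ.real (ball 0 R) := by
    rw [integral_finsetSum _ hint]
    simp_rw [integral_mul_const]
    rw [Finset.sum_congr rfl fun t ht => by rw [hvol t (hs ht)], ← Finset.mul_sum, hsum, mul_one]
  simp only [hlag, integral_zero] at hfinal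
  exact (ENNReal.toReal_pos (measure_ball_pos μ 0 hR).ne' measure_ball_lt_top.ne).ne hfinal

theorem ContDiff.exists_isFixedPt_of_norm_le {E : Type*} [NormedAddCommGroup E]
    [InnerProductSpace ℝ E] [FiniteDimensional ℝ E] {g : E → E} {M : ℝ} (hg : ContDiff ℝ 1 g)
    (hM : ∀ x, ‖g x‖ ≤ M) : ∃ x, g x = x := by
  by_contra! hne
  have hM0 : 0 ≤ M := (norm_nonneg _).trans (hM 0)
  let χ : ContDiffBump (0 : E) := ⟨M + 1, M + 2, by linarith, by linarith⟩
  let u : E → E := fun x => x - χ x • g x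
  have hu : ContDiff ℝ 1 u := contDiff_id.sub (χ.contDiff.smul hg)
  have hu0 : ∀ x, u x ≠ 0 := by
    intro x hx
    have hx' : x = χ x • g x := sub_eq_zero.1 hx
    have hle : ‖x‖ ≤ M := by
      rw [hx', norm_smul, Real.norm_of_nonneg χ.nonneg]
      exact (mul_le_of_le_one_left (norm_nonneg _) χ.le_one).trans (hM x)
    have h1 : χ x = 1 := χ.one_of_mem_closedBall (by
      rw [mem_closedBall_zero_iff]
      change ‖x‖ ≤ M + 1
      linarith)
    rw [h1, one_smul] at hx'
    exact hne x hx'.symm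
  have hR : 0 < M + 3 := by linarith
  refine not_exists_contDiff_retraction_sphere (r := fun x => (M + 3) • (‖u x‖⁻¹ • u x)) hR
    ?_ ?_ ?_
  · exact (((hu.norm ℝ hu0).inv fun x => norm_ne_zero_iff.2 (hu0 x)).smul hu).const_smul _
  · intro x
    rw [norm_smul, norm_smul, norm_inv, norm_norm, inv_mul_cancel₀ (norm_ne_zero_iff.2 (hu0 x)),
      mul_one, Real.norm_of_nonneg hR.le]
  · intro x hx
    have h0 : χ x = 0 := χ.zero_of_le_dist (by
      rw [dist_zero_right, hx]
      change M + 2 ≤ M + 3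
      linarith)
    have hux : u x = x := by simp [u, h0]
    simp only [hux, hx]
    rw [smul_inv_smul₀ hR.ne']

theorem UniformContinuous.exists_isFixedPt_of_norm_le {E : Type*} [NormedAddCommGroup E]
    [InnerProductSpace ℝ E] [FiniteDimensional ℝ E] {f : E → E} {M : ℝ}
    (hf : UniformContinuous f) (hM : ∀ x, ‖f x‖ ≤ M) : ∃ x, f x = x := by
  have hM0 : 0 ≤ M := (norm_nonneg _).trans (hM 0)
  have : ProperSpace E := FiniteDimensional.proper ℝ E
  obtain ⟨x₀, -, hmin⟩ := (isCompact_closedBall (0 : E) (M + 1)).exists_isMinOn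
    ⟨0, Metric.mem_closedBall_self (by linarith)⟩
    (hf.continuous.sub continuous_id).norm.continuousOn
  refine ⟨x₀, ?_⟩
  by_contra hne
  have hpos : 0 < ‖f x₀ - x₀‖ := norm_pos_iff.2 (sub_ne_zero.2 hne)
  obtain ⟨g, hg, hgf⟩ := hf.exists_contDiff_dist_le (lt_min hpos one_pos)
  have hgM : ∀ x, ‖g x‖ ≤ M + 1 := fun x => by
    have h1 := (hgf x).trans_le (min_le_right _ _)
    rw [dist_eq_norm] at h1
    linarith [norm_le_norm_add_norm_sub' (g x) (f x), hM x]
  obtain ⟨x, hx⟩ := (hg.of_le (by exact_mod_cast le_top)).exists_isFixedPt_of_norm_le hgM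
  have hxM : x ∈ Metric.closedBall (0 : E) (M + 1) := by
    rw [mem_closedBall_zero_iff, ← hx]
    exact hgM x
  have h1 : ‖f x₀ - x₀‖ ≤ ‖f x - x‖ := hmin hxM
  have h2 := (hgf x).trans_le (min_le_left _ _)
  rw [hx, dist_comm, dist_eq_norm] at h2
  linarith

open scoped InnerProductSpace in
/-- The nearest-point retraction onto a complete convex set. -/
theorem Convex.exists_lipschitzWith_one_retraction {E : Type*} [NormedAddCommGroup E]
    [InnerProductSpace ℝ E] {D : Set E} (hconv : Convex ℝ D) (hne : D.Nonempty)
    (hcompl : IsComplete D) :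
    ∃ P : E → E, LipschitzWith 1 P ∧ (∀ x, P x ∈ D) ∧ ∀ x ∈ D, P x = x := by
  choose P hPD hP using exists_norm_eq_iInf_of_complete_convex hne hcompl hconv
  have hinner : ∀ u, ∀ w ∈ D, ⟪u - P u, w - P u⟫_ℝ ≤ 0 := fun u =>
    (norm_eq_iInf_iff_real_inner_le_zero hconv (hPD u)).1 (hP u)
  refine ⟨P, LipschitzWith.of_dist_le_mul fun u w => ?_, hPD, fun x hx => ?_⟩
  · rw [NNReal.coe_one, one_mul, dist_eq_norm, dist_eq_norm]
    have h1 := hinner u (P w) (hPD w)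
    have h2 := hinner w (P u) (hPD u)
    have h3 : ‖P u - P w‖ ^ 2 = ⟪u - w, P u - P w⟫_ℝ + ⟪u - P u, P w - P u⟫_ℝ
        + ⟪w - P w, P u - P w⟫_ℝ := by
      rw [← real_inner_self_eq_norm_sq, ← neg_sub (P u) (P w), inner_neg_right, ← sub_eq_add_neg,
        ← inner_sub_left, ← inner_add_left]
      congr 1
      abel
    have h4 := real_inner_le_norm (u - w) (P u - P w)
    by_contra! hlt
    nlinarith [norm_nonneg (u - w)]
  · have h := hinner x x hx
    rw [real_inner_self_nonpos, sub_eq_zero] at h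
    exact h.symm

/-- **Brouwer fixed-point theorem** in a Euclidean space. -/
theorem IsCompact.exists_isFixedPt_of_convex_of_innerProductSpace {E : Type*}
    [NormedAddCommGroup E] [InnerProductSpace ℝ E] [FiniteDimensional ℝ E] {D : Set E}
    (hcomp : IsCompact D) (hconv : Convex ℝ D) (hne : D.Nonempty) {f : E → E}
    (hf : ContinuousOn f D) (hmaps : Set.MapsTo f D D) : ∃ x ∈ D, f x = x := by
  obtain ⟨P, hP, hPD, hPid⟩ := hconv.exists_lipschitzWith_one_retraction hne hcomp.isComplete
  obtain ⟨M, hM⟩ := hcomp.isBounded.exists_norm_le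
  have huc : UniformContinuous (f ∘ P) := by
    rw [← uniformContinuousOn_univ]
    exact (hcomp.uniformContinuousOn_of_continuous hf).comp
      hP.uniformContinuous.uniformContinuousOn fun x _ => hPD x
  obtain ⟨x, hx⟩ := huc.exists_isFixedPt_of_norm_le fun x => hM _ (hmaps (hPD x))
  have hxD : x ∈ D := hx ▸ hmaps (hPD x)
  exact ⟨x, hxD, by simpa [hPid x hxD] using hx⟩

/-- **Brouwer fixed-point theorem** for a compact convex subset of a finite-dimensional space. -/
theorem IsCompact.exists_isFixedPt_of_convex {E : Type*} [NormedAddCommGroup E] [NormedSpace ℝ E]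
    [FiniteDimensional ℝ E] {D : Set E} (hcomp : IsCompact D) (hconv : Convex ℝ D)
    (hne : D.Nonempty) {f : E → E} (hf : ContinuousOn f D) (hmaps : Set.MapsTo f D D) :
    ∃ x ∈ D, f x = x := by
  let e : E ≃L[ℝ] _ := toEuclidean
  have hsymm : Set.MapsTo e.symm (e '' D) D := by
    rintro _ ⟨x, hx, rfl⟩
    simpa using hx
  obtain ⟨_, ⟨x, hx, rfl⟩, hfx⟩ :=
    (hcomp.image e.continuous).exists_isFixedPt_of_convex_of_innerProductSpace
      (hconv.is_linear_image e.toLinearEquiv.toLinearMap.isLinear) (hne.image e)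
      (e.continuous.comp_continuousOn (hf.comp e.symm.continuous.continuousOn hsymm))
      (fun y hy => Set.mem_image_of_mem e (hmaps (hsymm hy)))
  exact ⟨x, hx, by simpa using hfx⟩

/-- A continuous semiflow on a nonempty compact convex subset of a finite-dimensional
real normed vector space has a common fixed point. -/
theorem semiflow_has_fixed_point {E : Type*} [NormedAddCommGroup E] [NormedSpace ℝ E]
    [FiniteDimensional ℝ E]
    (D : Set E) (hne : D.Nonempty) (hcomp : IsCompact D) (hconv : Convex ℝ D)
    (φ : ℝ × E → E)
    (hmaps : ∀ t : ℝ, 0 ≤ t → ∀ x ∈ D, φ (t, x) ∈ D)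
    (hcont : ContinuousOn φ (Set.Ici (0 : ℝ) ×ˢ D))
    (hid : ∀ x ∈ D, φ (0, x) = x)
    (hsemi : ∀ s t : ℝ, 0 ≤ s → 0 ≤ t → ∀ x ∈ D, φ (s + t, x) = φ (s, φ (t, x))) :
    ∃ x₀ ∈ D, ∀ t : ℝ, 0 ≤ t → φ (t, x₀) = x₀ := by
  have hfix : ∀ s : ℝ, 0 ≤ s → ∃ x ∈ D, φ (s, x) = x := fun s hs =>
    hcomp.exists_isFixedPt_of_convex hconv hne
      (hcont.comp (by fun_prop) fun x hx => ⟨hs, hx⟩) (hmaps s hs)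
  have hmul : ∀ s : ℝ, 0 ≤ s → ∀ x ∈ D, φ (s, x) = x → ∀ m : ℕ, φ (m * s, x) = x := by
    intro s hs x hx hsx m
    induction m with
    | zero => simpa using hid x hx
    | succ m ih => rw [Nat.cast_succ, add_one_mul, hsemi _ _ (by positivity) hs x hx, hsx, ih]
  choose x hxD hx using fun n : ℕ => hfix (1 / (n + 1)) (by positivity)
  obtain ⟨x₀, hx₀, k, hk, hlim⟩ := hcomp.tendsto_subseq hxD
  refine ⟨x₀, hx₀, fun t ht => ?_⟩
  let τ : ℕ → ℝ := fun n => ⌊t * (n + 1)⌋₊ * (1 / (n + 1))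
  have hτ0 : ∀ n, 0 ≤ τ n := fun n => by positivity
  have hτ : Filter.Tendsto τ Filter.atTop (nhds t) := by
    have h := (tendsto_nat_floor_mul_div_atTop ht).comp
      (Filter.tendsto_atTop_add_const_right _ (1 : ℝ) tendsto_natCast_atTop_atTop)
    simpa [τ, Function.comp_def, div_eq_mul_inv] using h
  have hpair : Filter.Tendsto (fun n => (τ (k n), x (k n))) Filter.atTop
      (nhdsWithin (t, x₀) (Set.Ici (0 : ℝ) ×ˢ D)) :=
    tendsto_nhdsWithin_iff.2 ⟨(hτ.comp hk.tendsto_atTop).prodMk_nhds hlim,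
      Filter.Eventually.of_forall fun n => ⟨hτ0 _, hxD _⟩⟩
  have hφ := (hcont (t, x₀) ⟨ht, hx₀⟩).tendsto.comp hpair
  refine tendsto_nhds_unique hφ (hlim.congr fun n => ?_)
  exact (hmul _ (by positivity) _ (hxD _) (hx _) _).symm
end

section
/- There exist a finite number of extremal steady states ρ₁, …, ρ_K of the Lindblad generator whose supports are pairwise orthogonal subspaces of ℂ^N and such that the smallest subspace of ℂ^N containing the supports of all steady states equals the (orthogonal direct) sum of the supports of ρ₁, …, ρ_K: ⨆_{ρ steady state} supp(ρ) = ⨆_{k=1}^K supp(ρ_k). -/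
open Matrix
open scoped ComplexOrder

namespace Lindblad

variable {n : Type*} [Fintype n] {ι : Type*} [Fintype ι]

/-- The effective (non-self-adjoint) drift `-iH - ½ Σ_d V_d† V_d` of the Lindblad generator. -/
noncomputable def drift (H : Matrix n n ℂ) (V : ι → Matrix n n ℂ) : Matrix n n ℂ :=
  -Complex.I • H - (1 / 2 : ℂ) • ∑ d, (V d)ᴴ * V d

lemma conjTranspose_drift {H : Matrix n n ℂ} (hH : H.IsHermitian) (V : ι → Matrix n n ℂ) :
    (drift H V)ᴴ = Complex.I • H - (1 / 2 : ℂ) • ∑ d, (V d)ᴴ * V d := by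
  simp [drift, conjTranspose_sum, hH.eq]

lemma drift_add_conjTranspose {H : Matrix n n ℂ} (hH : H.IsHermitian) (V : ι → Matrix n n ℂ) :
    drift H V + (drift H V)ᴴ = -∑ d, (V d)ᴴ * V d := by
  rw [conjTranspose_drift hH, drift]
  module

/-- `P` is the matrix of the orthogonal projection onto `R`. -/
structure IsProjectionOnto (P : Matrix n n ℂ) (R : Submodule ℂ (n → ℂ)) : Prop where
  isHermitian : P.IsHermitian
  mul_self : P * P = P
  mulVec_eq_iff : ∀ x, P *ᵥ x = x ↔ x ∈ R

lemma IsProjectionOnto.mulVec_mem {P : Matrix n n ℂ} {R : Submodule ℂ (n → ℂ)}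
    (hP : IsProjectionOnto P R) (x : n → ℂ) : P *ᵥ x ∈ R := by
  rw [← hP.mulVec_eq_iff, mulVec_mulVec, hP.mul_self]

/-- The supports of two matrices are orthogonal. -/
def OrthogonalSupports (A B : Matrix n n ℂ) : Prop :=
  ∀ x ∈ matSupport A, ∀ y ∈ matSupport B, star x ⬝ᵥ y = 0

lemma OrthogonalSupports.symm {A B : Matrix n n ℂ} (h : OrthogonalSupports A B) :
    OrthogonalSupports B A := fun x hx y hy => by
  rw [← star_eq_zero, star_dotProduct, star_star]
  exact h y hy x hx

lemma IsProjectionOnto.orthogonalSupports {P : Matrix n n ℂ} {R : Submodule ℂ (n → ℂ)}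
    (hP : IsProjectionOnto P R) {A B : Matrix n n ℂ} (hA : P * A = 0) (hB : matSupport B ≤ R) :
    OrthogonalSupports A B := by
  rintro _ ⟨x, rfl⟩ y hy
  rw [← (hP.mulVec_eq_iff y).2 (hB hy), mulVecLin_apply, dotProduct_mulVec, ← hP.isHermitian.eq,
    ← star_mulVec, mulVec_mulVec, hA, zero_mulVec, star_zero, zero_dotProduct]

variable [DecidableEq n]

lemma lindblad_eq_drift {H : Matrix n n ℂ} (hH : H.IsHermitian) (V : ι → Matrix n n ℂ)
    (ρ : Matrix n n ℂ) :
    lindblad H V ρ = drift H V * ρ + ρ * (drift H V)ᴴ + ∑ d, V d * ρ * (V d)ᴴ := by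
  rw [conjTranspose_drift hH, drift, lindblad, Finset.sum_sub_distrib, ← Finset.smul_sum,
    Finset.sum_add_distrib, ← Finset.sum_mul, ← Finset.mul_sum]
  simp only [sub_mul, mul_sub, smul_mul_assoc, mul_smul_comm]
  module

lemma trace_lindblad {H : Matrix n n ℂ} (hH : H.IsHermitian) (V : ι → Matrix n n ℂ)
    (ρ : Matrix n n ℂ) : (lindblad H V ρ).trace = 0 := by
  have h : (∑ d, V d * ρ * (V d)ᴴ).trace = ((∑ d, (V d)ᴴ * V d) * ρ).trace := by
    simp only [Finset.sum_mul, trace_sum]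
    exact Finset.sum_congr rfl fun d _ => by rw [trace_mul_comm, Matrix.mul_assoc]
  rw [lindblad_eq_drift hH, trace_add, trace_add, trace_mul_comm ρ, ← trace_add, ← add_mul,
    drift_add_conjTranspose hH, h, neg_mul, trace_neg, neg_add_cancel]

lemma lindblad_smul {H : Matrix n n ℂ} (hH : H.IsHermitian) (V : ι → Matrix n n ℂ)
    (a : ℂ) (ρ : Matrix n n ℂ) : lindblad H V (a • ρ) = a • lindblad H V ρ := by
  simp [lindblad_eq_drift hH, Finset.smul_sum]

open scoped MatrixOrder in
lemma exists_eq_conjTranspose_mul_self {ρ : Matrix n n ℂ} (hρ : ρ.PosSemidef) :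
    ∃ B : Matrix n n ℂ, ρ = Bᴴ * B :=
  CStarAlgebra.nonneg_iff_eq_star_mul_self.mp hρ.nonneg

lemma mul_eq_zero_of_trace_conj {ρ : Matrix n n ℂ} (hρ : ρ.PosSemidef) (A : Matrix n n ℂ)
    (h : (A * ρ * Aᴴ).trace = 0) : A * ρ = 0 := by
  obtain ⟨B, rfl⟩ := exists_eq_conjTranspose_mul_self hρ
  have h' : A * Bᴴ = 0 := by
    rw [← trace_mul_conjTranspose_self_eq_zero_iff, ← h]
    simp [Matrix.mul_assoc]
  rw [← Matrix.mul_assoc, h', zero_mul]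

lemma mul_eq_zero_of_sum_trace_conj {ρ : Matrix n n ℂ} (hρ : ρ.PosSemidef)
    (A : ι → Matrix n n ℂ) (h : (∑ d, A d * ρ * (A d)ᴴ).trace = 0) (d : ι) : A d * ρ = 0 := by
  rw [trace_sum, Finset.sum_eq_zero_iff_of_nonneg
    fun d _ => (hρ.mul_mul_conjTranspose_same (A d)).trace_nonneg] at h
  exact mul_eq_zero_of_trace_conj hρ _ (h d (Finset.mem_univ d))

lemma exists_isProjectionOnto (R : Submodule ℂ (n → ℂ)) :
    ∃ P : Matrix n n ℂ, IsProjectionOnto P R := by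
  let S : Submodule ℂ (EuclideanSpace ℂ n) :=
    R.comap (WithLp.linearEquiv 2 ℂ (n → ℂ)).toLinearMap
  obtain ⟨P, hP⟩ := (Matrix.toEuclideanLin (𝕜 := ℂ) (m := n) (n := n)).surjective
    S.starProjection.toLinearMap
  have hfix : ∀ x, P *ᵥ x = x ↔ x ∈ R := fun x => by
    have h : P.toEuclideanLin (WithLp.toLp 2 x) = S.starProjection (WithLp.toLp 2 x) := by
      rw [hP]; rfl
    rw [toLpLin_toLp, toLin'_apply] at h
    rw [← (WithLp.toLp_injective 2).eq_iff, h, Submodule.starProjection_eq_self_iff]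
    rfl
  refine ⟨P, ⟨?_, ?_, hfix⟩⟩
  · rw [← isSymmetric_toEuclideanLin_iff, hP]
    exact S.starProjection_isSymmetric
  · refine Matrix.ext_of_mulVec_single fun i => ?_
    rw [← mulVec_mulVec, hfix]
    have h : P.toEuclideanLin (WithLp.toLp 2 (Pi.single i 1)) ∈ S := by
      rw [hP]
      exact S.starProjection_apply_mem _
    rwa [toLpLin_toLp] at h

namespace IsProjectionOnto

variable {P : Matrix n n ℂ} {R : Submodule ℂ (n → ℂ)}

lemma mul_eq_iff (hP : IsProjectionOnto P R) (A : Matrix n n ℂ) :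
    P * A = A ↔ matSupport A ≤ R := by
  constructor
  · rintro h _ ⟨x, rfl⟩
    rw [mulVecLin_apply, ← hP.mulVec_eq_iff, mulVec_mulVec, h]
  · intro h
    refine Matrix.ext_of_mulVec_single fun i => ?_
    rw [← mulVec_mulVec, hP.mulVec_eq_iff]
    exact h ⟨_, rfl⟩

lemma mul_mul_eq_of_mapsTo (hP : IsProjectionOnto P R) {A : Matrix n n ℂ}
    (hA : ∀ x ∈ R, A *ᵥ x ∈ R) : P * (A * P) = A * P := by
  rw [hP.mul_eq_iff]
  rintro _ ⟨x, rfl⟩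
  rw [mulVecLin_apply, ← mulVec_mulVec]
  exact hA _ (hP.mulVec_mem x)

end IsProjectionOnto

/-- The support of a positive semidefinite zero of the Lindblad generator is invariant under
the jump operators and the drift. -/
lemma matSupport_invariant {H : Matrix n n ℂ} (hH : H.IsHermitian) {V : ι → Matrix n n ℂ}
    {ρ : Matrix n n ℂ} (hρ : ρ.PosSemidef) (hL : lindblad H V ρ = 0) :
    (∀ d, ∀ x ∈ matSupport ρ, V d *ᵥ x ∈ matSupport ρ) ∧
      ∀ x ∈ matSupport ρ, drift H V *ᵥ x ∈ matSupport ρ := by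
  obtain ⟨P, hP⟩ := exists_isProjectionOnto (matSupport ρ)
  have hPρ : P * ρ = ρ := (hP.mul_eq_iff ρ).2 le_rfl
  have hρP : ρ * P = ρ := by
    simpa [hP.isHermitian.eq, hρ.isHermitian.eq] using congrArg conjTranspose hPρ
  set Q := 1 - P with hQ
  have hQρ : Q * ρ = 0 := by rw [hQ, sub_mul, one_mul, hPρ, sub_self]
  have hρQ : ρ * Q = 0 := by rw [hQ, mul_sub, mul_one, hρP, sub_self]
  have hQH : Qᴴ = Q := by simp [hQ, hP.isHermitian.eq]
  rw [lindblad_eq_drift hH] at hL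
  have hmem : ∀ A : Matrix n n ℂ, Q * (A * ρ) = 0 →
      ∀ x ∈ matSupport ρ, A *ᵥ x ∈ matSupport ρ := by
    rintro A hA _ ⟨x, rfl⟩
    rw [hQ, sub_mul, one_mul, sub_eq_zero, eq_comm, hP.mul_eq_iff] at hA
    rw [mulVecLin_apply, mulVec_mulVec]
    exact hA ⟨x, rfl⟩
  have hV : ∀ d, Q * V d * ρ = 0 := by
    refine mul_eq_zero_of_sum_trace_conj hρ (fun d => Q * V d) ?_
    have h : ∑ d, Q * V d * ρ * (Q * V d)ᴴ = 0 := by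
      have h := congrArg (fun X => Q * X * Q) hL
      simp only [mul_add, add_mul, mul_zero, zero_mul, Finset.mul_sum, Finset.sum_mul] at h
      rw [← Matrix.mul_assoc Q ρ, hQρ, Matrix.mul_assoc Q (_ * ρ), Matrix.mul_assoc _ ρ Q, hρQ]
        at h
      simpa [Matrix.mul_assoc, hQH] using h
    rw [h, trace_zero]
  refine ⟨fun d => hmem _ (by rw [← Matrix.mul_assoc, hV d]), hmem _ ?_⟩
  have h := congrArg (fun X => Q * X) hL
  simp only [mul_add, mul_zero, Finset.mul_sum, ← Matrix.mul_assoc, hV, hQρ] at h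
  simpa [Matrix.mul_assoc] using h

/-- Compressing a positive semidefinite zero of the Lindblad generator to the orthogonal complement
of an invariant subspace gives another zero of the generator. -/
lemma lindblad_compression_eq_zero {H : Matrix n n ℂ} (hH : H.IsHermitian)
    {V : ι → Matrix n n ℂ} {Q : Matrix n n ℂ} (hQH : Q.IsHermitian) (hQQ : Q * Q = Q)
    (hV : ∀ d, Q * V d = Q * V d * Q) (hK : Q * drift H V = Q * drift H V * Q)
    {ρ : Matrix n n ℂ} (hρ : ρ.PosSemidef) (hL : lindblad H V ρ = 0) :
    lindblad H V (Q * ρ * Q) = 0 := by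
  set σ := Q * ρ * Q with hσ
  have hσ_psd : σ.PosSemidef := by
    simpa [hQH.eq] using hρ.mul_mul_conjTranspose_same Q
  have hVs : ∀ d, (V d)ᴴ * Q = Q * (V d)ᴴ * Q := fun d => by
    simpa [hQH.eq, Matrix.mul_assoc] using congrArg conjTranspose (hV d)
  have hKs : (drift H V)ᴴ * Q = Q * (drift H V)ᴴ * Q := by
    simpa [hQH.eq, Matrix.mul_assoc] using congrArg conjTranspose hK
  have hQσ : Q * σ = σ := by simp only [hσ, ← Matrix.mul_assoc, hQQ]
  have hσQ : σ * Q = σ := by simp only [hσ, Matrix.mul_assoc, hQQ]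
  have hcomp : Q * drift H V * σ + σ * (drift H V)ᴴ * Q
      + ∑ d, Q * V d * σ * ((V d)ᴴ * Q) = 0 := by
    have h := congrArg (fun X => Q * X * Q) ((lindblad_eq_drift hH V ρ).symm.trans hL)
    simp only [mul_add, add_mul, mul_zero, zero_mul, Finset.mul_sum, Finset.sum_mul] at h
    rw [← h]
    congr 1
    · congr 1
      · rw [hσ, ← Matrix.mul_assoc, ← Matrix.mul_assoc, ← hK]
        simp only [Matrix.mul_assoc]
      · rw [hσ, Matrix.mul_assoc, Matrix.mul_assoc, ← Matrix.mul_assoc Q _ Q, ← hKs]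
        simp only [Matrix.mul_assoc]
    · refine Finset.sum_congr rfl fun d _ => ?_
      have h₁ : Q * V d * σ * ((V d)ᴴ * Q) = (Q * V d * Q) * ρ * (Q * (V d)ᴴ * Q) := by
        simp only [hσ, Matrix.mul_assoc]
      rw [h₁, ← hV, ← hVs]
      simp only [Matrix.mul_assoc]
  have hPV : ∀ d, (1 - Q) * V d * σ = 0 := by
    refine mul_eq_zero_of_sum_trace_conj hσ_psd (fun d => (1 - Q) * V d) ?_
    have ht := trace_lindblad hH V σ
    have hc := congrArg trace hcomp
    rw [lindblad_eq_drift hH] at ht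
    simp only [trace_add, trace_sum, trace_zero] at ht hc ⊢
    have e₁ : (Q * drift H V * σ).trace = (drift H V * σ).trace := by
      rw [Matrix.mul_assoc, trace_mul_comm, Matrix.mul_assoc, hσQ]
    have e₂ : (σ * (drift H V)ᴴ * Q).trace = (σ * (drift H V)ᴴ).trace := by
      rw [trace_mul_comm, ← Matrix.mul_assoc, hQσ]
    have e₃ : ∀ d, ((1 - Q) * V d * σ * ((1 - Q) * V d)ᴴ).trace
        = (V d * σ * (V d)ᴴ).trace - (Q * V d * σ * ((V d)ᴴ * Q)).trace := fun d => by
      have hidem : (1 - Q) * (1 - Q) = 1 - Q := by simp [mul_sub, sub_mul, hQQ]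
      have a₁ : ((1 - Q) * V d * σ * ((1 - Q) * V d)ᴴ).trace
          = ((1 - Q) * (V d * σ * (V d)ᴴ)).trace := by
        rw [conjTranspose_mul, conjTranspose_sub, conjTranspose_one, hQH.eq,
          ← Matrix.mul_assoc, trace_mul_comm]
        simp only [← Matrix.mul_assoc, hidem]
      have a₂ : (Q * V d * σ * ((V d)ᴴ * Q)).trace = (Q * (V d * σ * (V d)ᴴ)).trace := by
        rw [← Matrix.mul_assoc, trace_mul_comm]
        simp only [← Matrix.mul_assoc, hQQ]
      rw [a₁, a₂, sub_mul, one_mul, trace_sub]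
    simp only [e₃, Finset.sum_sub_distrib]
    rw [e₁, e₂] at hc
    linear_combination ht - hc
  have hVσ : ∀ d, Q * V d * σ = V d * σ := fun d => by
    have h := hPV d
    rw [sub_mul, one_mul, sub_mul, sub_eq_zero] at h
    exact h.symm
  have hKσ : Q * drift H V * σ = drift H V * σ := by
    have h : (1 - Q) * (drift H V + (drift H V)ᴴ) * σ = 0 := by
      rw [drift_add_conjTranspose hH, mul_neg, neg_mul, Finset.mul_sum, Finset.sum_mul,
        Finset.sum_eq_zero, neg_zero]
      intro d _
      have h₁ : (1 - Q) * ((V d)ᴴ * Q) = 0 := by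
        rw [sub_mul, one_mul, ← Matrix.mul_assoc, ← hVs, sub_self]
      calc (1 - Q) * ((V d)ᴴ * V d) * σ = (1 - Q) * (V d)ᴴ * (V d * σ) := by
            simp only [Matrix.mul_assoc]
        _ = (1 - Q) * ((V d)ᴴ * Q) * (V d * σ) := by
            rw [← hVσ]; simp only [← Matrix.mul_assoc]; simp only [Matrix.mul_assoc, hQQ]
        _ = 0 := by rw [h₁, zero_mul]
    have h₂ : (1 - Q) * (drift H V)ᴴ * σ = 0 := by
      rw [← hQσ, ← Matrix.mul_assoc, Matrix.mul_assoc (1 - Q), hKs, sub_mul, one_mul]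
      simp only [← Matrix.mul_assoc, hQQ, sub_self, zero_mul]
    rw [mul_add, add_mul, h₂, add_zero, sub_mul, one_mul, sub_mul, sub_eq_zero] at h
    exact h.symm
  have hσK : σ * (drift H V)ᴴ * Q = σ * (drift H V)ᴴ := by
    simpa [hQH.eq, hσ_psd.isHermitian.eq, Matrix.mul_assoc] using congrArg conjTranspose hKσ
  have hσV : ∀ d, σ * ((V d)ᴴ * Q) = σ * (V d)ᴴ := fun d => by
    simpa [hQH.eq, hσ_psd.isHermitian.eq, Matrix.mul_assoc] using congrArg conjTranspose (hVσ d)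
  rw [lindblad_eq_drift hH, ← hcomp, hKσ, hσK]
  congr 1
  refine Finset.sum_congr rfl fun d _ => ?_
  rw [hVσ, Matrix.mul_assoc, Matrix.mul_assoc _ _ (_ * Q), hσV]

lemma isCompact_setOf_isSteadyState {H : Matrix n n ℂ} (hH : H.IsHermitian)
    (V : ι → Matrix n n ℂ) (P : Matrix n n ℂ) :
    IsCompact {ρ | IsSteadyState H V ρ ∧ P * ρ = 0} := by
  have hcL : Continuous fun ρ : Matrix n n ℂ => lindblad H V ρ := by
    simp only [lindblad_eq_drift hH]
    fun_prop
  let T : Set (Matrix n n ℂ) :=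
    Set.univ.pi fun _ => Set.univ.pi fun _ => Metric.closedBall (0 : ℂ) 1
  have hT : IsCompact T :=
    isCompact_univ_pi fun _ => isCompact_univ_pi fun _ => isCompact_closedBall 0 1
  have hcB : Continuous fun B : Matrix n n ℂ => Bᴴ * B := by fun_prop
  let C : Set (Matrix n n ℂ) :=
    {B | (Bᴴ * B).trace = 1 ∧ lindblad H V (Bᴴ * B) = 0 ∧ P * (Bᴴ * B) = 0}
  have hC : IsClosed C := by
    refine (isClosed_eq (by fun_prop) continuous_const).inter
      ((isClosed_eq (hcL.comp hcB) continuous_const).inter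
        (isClosed_eq (by fun_prop) continuous_const))
  convert (hT.inter_right hC).image hcB using 1
  ext ρ
  constructor
  · rintro ⟨⟨⟨hρ, htr⟩, hL⟩, hPρ⟩
    obtain ⟨B, rfl⟩ := exists_eq_conjTranspose_mul_self hρ
    refine ⟨B, ⟨fun i _ j _ => ?_, htr, hL, hPρ⟩, rfl⟩
    have hsum : ∑ j, ∑ i, ‖B i j‖ ^ 2 = 1 := by
      have h : ((∑ j, ∑ i, ‖B i j‖ ^ 2 : ℝ) : ℂ) = 1 := by
        rw [← htr]
        simp [trace, mul_apply, Complex.conj_mul']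
      exact_mod_cast h
    have h₁ : ‖B i j‖ ^ 2 ≤ ∑ i, ‖B i j‖ ^ 2 :=
      Finset.single_le_sum (f := fun i => ‖B i j‖ ^ 2) (fun _ _ => sq_nonneg _)
        (Finset.mem_univ i)
    have h₂ : ∑ i, ‖B i j‖ ^ 2 ≤ ∑ j, ∑ i, ‖B i j‖ ^ 2 :=
      Finset.single_le_sum (f := fun j => ∑ i, ‖B i j‖ ^ 2)
        (fun _ _ => Finset.sum_nonneg fun _ _ => sq_nonneg _) (Finset.mem_univ j)
    rw [mem_closedBall_zero_iff]
    nlinarith [norm_nonneg (B i j)]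
  · rintro ⟨B, ⟨-, htr, hL, hPB⟩, rfl⟩
    exact ⟨⟨⟨posSemidef_conjTranspose_mul_self B, htr⟩, hL⟩, hPB⟩

/-- If some steady state is annihilated by the projection `P`, so is an extremal one. -/
lemma exists_isExtremalSteadyState {H : Matrix n n ℂ} (hH : H.IsHermitian)
    {V : ι → Matrix n n ℂ} {P : Matrix n n ℂ}
    (hne : ∃ ρ, IsSteadyState H V ρ ∧ P * ρ = 0) :
    ∃ τ, IsExtremalSteadyState H V τ ∧ P * τ = 0 := by
  have : LocallyConvexSpace ℝ (Matrix n n ℂ) :=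
    inferInstanceAs (LocallyConvexSpace ℝ (n → n → ℂ))
  obtain ⟨τ, hτ⟩ := (isCompact_setOf_isSteadyState hH V P).extremePoints_nonempty hne
  rw [mem_extremePoints] at hτ
  obtain ⟨⟨hτs, hPτ⟩, hext⟩ := hτ
  refine ⟨τ, ⟨hτs, fun a ρ₁ ρ₂ ha₀ ha₁ h₁ h₂ heq => ?_⟩, hPτ⟩
  have hb : 0 < 1 - a := sub_pos.2 ha₁
  have hnn : ∀ ρ, IsSteadyState H V ρ → 0 ≤ (P * ρ * Pᴴ).trace := fun ρ hρ =>
    (hρ.1.1.mul_mul_conjTranspose_same P).trace_nonneg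
  have hsum : (a : ℂ) * (P * ρ₁ * Pᴴ).trace + ((1 - a : ℝ) : ℂ) * (P * ρ₂ * Pᴴ).trace = 0 := by
    have h : (P * τ * Pᴴ).trace = 0 := by rw [hPτ, zero_mul, trace_zero]
    rw [heq] at h
    simpa [mul_add, add_mul, trace_add, trace_smul] using h
  have ha' : (0 : ℂ) < a := by exact_mod_cast ha₀
  have hb' : (0 : ℂ) < ((1 - a : ℝ) : ℂ) := by exact_mod_cast hb
  rw [add_eq_zero_iff_of_nonneg (mul_nonneg ha'.le (hnn _ h₁)) (mul_nonneg hb'.le (hnn _ h₂)),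
    mul_eq_zero_iff_left ha'.ne', mul_eq_zero_iff_left hb'.ne'] at hsum
  exact hext ρ₁ ⟨h₁, mul_eq_zero_of_trace_conj h₁.1.1 P hsum.1⟩
    ρ₂ ⟨h₂, mul_eq_zero_of_trace_conj h₂.1.1 P hsum.2⟩
    ⟨a, 1 - a, ha₀, hb, add_sub_cancel _ _, heq.symm⟩

/-- If the support of some steady state is not contained in the invariant subspace `R`, then some
extremal steady state is supported in the orthogonal complement of `R`. -/
lemma exists_isExtremalSteadyState_of_not_le {H : Matrix n n ℂ} (hH : H.IsHermitian)
    {V : ι → Matrix n n ℂ} {P : Matrix n n ℂ} {R : Submodule ℂ (n → ℂ)}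
    (hP : IsProjectionOnto P R) (hV : ∀ d, ∀ x ∈ R, V d *ᵥ x ∈ R)
    (hK : ∀ x ∈ R, drift H V *ᵥ x ∈ R) {ρ : Matrix n n ℂ} (hρ : IsSteadyState H V ρ)
    (hR : ¬ matSupport ρ ≤ R) :
    ∃ τ, IsExtremalSteadyState H V τ ∧ P * τ = 0 := by
  apply exists_isExtremalSteadyState hH
  set Q := 1 - P with hQ
  have hQH : Q.IsHermitian := isHermitian_one.sub hP.isHermitian
  have hPQ : P * Q = 0 := by rw [hQ, mul_sub, mul_one, hP.mul_self, sub_self]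
  have hQQ : Q * Q = Q := by rw [hQ, sub_mul, ← hQ, hPQ, one_mul, sub_zero]
  have hinv : ∀ A : Matrix n n ℂ, (∀ x ∈ R, A *ᵥ x ∈ R) → Q * A = Q * A * Q := fun A hA => by
    have h := hP.mul_mul_eq_of_mapsTo hA
    have h' : Q * A * P = 0 := by
      rw [Matrix.mul_assoc, hQ, sub_mul, one_mul, h, sub_self]
    conv_rhs => rw [hQ, mul_sub, mul_one, ← hQ, h', sub_zero]
  have hL := lindblad_compression_eq_zero hH hQH hQQ (fun d => hinv _ (hV d)) (hinv _ hK)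
    hρ.1.1 hρ.2
  have hpsd : (Q * ρ * Q).PosSemidef := by
    simpa [hQH.eq] using hρ.1.1.mul_mul_conjTranspose_same Q
  have htr : (Q * ρ * Q).trace ≠ 0 := fun h => hR <| by
    have h' := mul_eq_zero_of_trace_conj hρ.1.1 Q (by rwa [hQH.eq])
    rw [hQ, sub_mul, one_mul, sub_eq_zero] at h'
    exact (hP.mul_eq_iff ρ).1 h'.symm
  refine ⟨(Q * ρ * Q).trace⁻¹ • (Q * ρ * Q), ⟨⟨?_, ?_⟩, ?_⟩, ?_⟩
  · exact hpsd.smul (inv_nonneg.2 hpsd.trace_nonneg)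
  · rw [trace_smul, smul_eq_mul, inv_mul_cancel₀ htr]
  · rw [lindblad_smul hH, hL, smul_zero]
  · rw [mul_smul_comm, ← Matrix.mul_assoc, ← Matrix.mul_assoc, hPQ, zero_mul, zero_mul,
      smul_zero]

/-- The sums of supports of finite families of extremal steady states with pairwise orthogonal
supports. -/
def orthogonalSupportSums (H : Matrix n n ℂ) (V : ι → Matrix n n ℂ) :
    Set (Submodule ℂ (n → ℂ)) :=
  {R | ∃ (K : ℕ) (ρs : Fin K → Matrix n n ℂ), (∀ k, IsExtremalSteadyState H V (ρs k)) ∧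
    (∀ k l, k ≠ l → OrthogonalSupports (ρs k) (ρs l)) ∧ R = ⨆ k, matSupport (ρs k)}

/-- A sum of orthogonal extremal supports missing part of the support of a steady state is not
maximal. -/
lemma exists_lt_mem_orthogonalSupportSums {H : Matrix n n ℂ} (hH : H.IsHermitian)
    {V : ι → Matrix n n ℂ} {R : Submodule ℂ (n → ℂ)} (hR : R ∈ orthogonalSupportSums H V)
    {ρ : Matrix n n ℂ} (hρ : IsSteadyState H V ρ) (hρR : ¬ matSupport ρ ≤ R) :
    ∃ R' ∈ orthogonalSupportSums H V, R < R' := by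
  obtain ⟨K, ρs, hext, horth, rfl⟩ := hR
  have hinv : ∀ A : Matrix n n ℂ,
      (∀ k, ∀ x ∈ matSupport (ρs k), A *ᵥ x ∈ matSupport (ρs k)) →
      ∀ x ∈ ⨆ k, matSupport (ρs k), A *ᵥ x ∈ ⨆ k, matSupport (ρs k) := fun A hA => by
    have h : ⨆ k, matSupport (ρs k) ≤ (⨆ k, matSupport (ρs k)).comap A.mulVecLin :=
      iSup_le fun k x hx => Submodule.mem_iSup_of_mem k (hA k x hx)
    exact h
  have hs := fun k => matSupport_invariant hH (hext k).1.1.1 (hext k).1.2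
  obtain ⟨P, hP⟩ := exists_isProjectionOnto (⨆ k, matSupport (ρs k))
  obtain ⟨τ, hτ, hPτ⟩ := exists_isExtremalSteadyState_of_not_le hH hP
    (fun d => hinv _ fun k => (hs k).1 d) (hinv _ fun k => (hs k).2) hρ hρR
  have horthτ : ∀ k, OrthogonalSupports τ (ρs k) := fun k =>
    hP.orthogonalSupports hPτ (le_iSup (fun k => matSupport (ρs k)) k)
  let ρs' : Fin (K + 1) → Matrix n n ℂ := Fin.cons τ ρs
  refine ⟨_, ⟨K + 1, ρs', Fin.cases hτ hext, ?_, rfl⟩, ?_⟩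
  · intro k l
    refine Fin.cases ?_ (fun k => ?_) k <;> refine Fin.cases ?_ (fun l => ?_) l
    · exact fun h => absurd rfl h
    · exact fun _ => horthτ l
    · exact fun _ => (horthτ k).symm
    · exact fun h => horth k l fun hkl => h (congrArg Fin.succ hkl)
  · refine lt_of_le_of_ne (iSup_le fun k => le_iSup (fun k => matSupport (ρs' k)) k.succ) ?_
    intro heq
    have hle : matSupport τ ≤ ⨆ k, matSupport (ρs k) :=
      heq ▸ le_iSup (fun k => matSupport (ρs' k)) 0
    have h0 : τ = 0 := ((hP.mul_eq_iff τ).2 hle).symm.trans hPτ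
    simpa [h0] using hτ.1.1.2

end Lindblad

/-- There are finitely many extremal steady states with pairwise orthogonal supports
whose supports sum to the smallest subspace containing the supports of all steady
states. -/
theorem steady_state_support_decomposition (N : ℕ) (hN : 1 ≤ N)
    (H : Matrix (Fin N) (Fin N) ℂ) (hH : H.IsHermitian)
    {ι : Type*} [Fintype ι] (V : ι → Matrix (Fin N) (Fin N) ℂ) :
    ∃ (K : ℕ) (ρs : Fin K → Matrix (Fin N) (Fin N) ℂ),
      (∀ k, IsExtremalSteadyState H V (ρs k)) ∧
      (∀ k l, k ≠ l →
        ∀ x ∈ matSupport (ρs k), ∀ y ∈ matSupport (ρs l), star x ⬝ᵥ y = 0) ∧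
      (⨆ ρ ∈ {ρ : Matrix (Fin N) (Fin N) ℂ | IsSteadyState H V ρ}, matSupport ρ)
        = ⨆ k, matSupport (ρs k) := by
  obtain ⟨R, hR, hmax⟩ := wellFounded_gt.has_min (Lindblad.orthogonalSupportSums H V)
    ⟨_, 0, Fin.elim0, fun k => k.elim0, fun k => k.elim0, rfl⟩
  have hle : ∀ ρ, IsSteadyState H V ρ → matSupport ρ ≤ R := fun ρ hρ => by
    by_contra h
    obtain ⟨R', hR', hlt⟩ := Lindblad.exists_lt_mem_orthogonalSupportSums hH hR hρ h
    exact hmax R' hR' hlt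
  obtain ⟨K, ρs, hext, horth, rfl⟩ := hR
  refine ⟨K, ρs, hext, horth, le_antisymm (iSup₂_le hle) (iSup_le fun k => ?_)⟩
  exact le_iSup₂ (f := fun ρ (_ : ρ ∈ {ρ | IsSteadyState H V ρ}) => matSupport ρ)
    (ρs k) (hext k).1
end
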